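/- arXiv:2012.14189 — 3 statements merged into one kernel-verified Lean document; each statement's English description precedes it below -/
import Mathlib

section
/- Let α,β,γ > -1 be real, let 0 ≤ k ≤ n be integers, and let f be n times continuously differentiable on an open neighbourhood of a point (x,y) ∈ ℝ². Then ∂ⁿf/∂xᵏ∂y^{n-k}(x,y) = (-1)ⁿ/B(α+1+k, β+1+n-k, γ+1+n) · lim_{δ↓0} δ^{-n} ∬_{T²} f(x+δu, y+δv) · U_{k,n}^{α,β,γ}(u,v) · u^α v^β (1-u-v)^γ dv du. -/
open Real MeasureTheory Filter

/-- Iterated partial derivative `∂^{k+l}/∂x^k ∂y^l` of a two-variable function. -/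
noncomputable def pderiv2 (k l : ℕ) (f : ℝ → ℝ → ℝ) (x y : ℝ) : ℝ :=
  iteratedDeriv k (fun s => iteratedDeriv l (fun t => f s t) y) x

/-- Extended Beta function `B(x,y,z) = Γ(x)Γ(y)Γ(z)/Γ(x+y+z)`. -/
noncomputable def Beta3 (x y z : ℝ) : ℝ :=
  Real.Gamma x * Real.Gamma y * Real.Gamma z / Real.Gamma (x + y + z)

/-- The Appell polynomial `U_{k,n}^{α,β,γ}` given by the Rodrigues-type formula. -/
noncomputable def Ukn (α β γ : ℝ) (k n : ℕ) (x y : ℝ) : ℝ :=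
  (x ^ α * y ^ β * (1 - x - y) ^ γ)⁻¹ *
    pderiv2 k (n - k) (fun u v =>
      u ^ ((k : ℝ) + α) * v ^ ((n : ℝ) - (k : ℝ) + β) * (1 - u - v) ^ ((n : ℝ) + γ)) x y

/-- The triangular region `T² = {(u,v) : 0 ≤ u, 0 ≤ v, u+v ≤ 1}`. -/
def T2 : Set (ℝ × ℝ) := {p | 0 ≤ p.1 ∧ 0 ≤ p.2 ∧ p.1 + p.2 ≤ 1}


/-- Open triangle. -/
def O2 : Set (ℝ × ℝ) := {p | 0 < p.1 ∧ 0 < p.2 ∧ p.1 + p.2 < 1}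

/-- The weight with general exponents. -/
noncomputable def ww (p : ℝ × ℝ) (a b c : ℝ) : ℝ := p.1 ^ a * p.2 ^ b * (1 - p.1 - p.2) ^ c

def opA (Φ : ℝ → ℝ → ℝ → ℝ) (a b c : ℝ) : ℝ := a * Φ (a - 1) b c - c * Φ a b (c - 1)

def opB (Φ : ℝ → ℝ → ℝ → ℝ) (a b c : ℝ) : ℝ := b * Φ a (b - 1) c - c * Φ a b (c - 1)

lemma opA_opB (Φ) : opA (opB Φ) = opB (opA Φ) := by
  funext a b c
  simp only [opA, opB]
  ring

lemma isOpen_O2 : IsOpen O2 := by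
  unfold O2
  exact (isOpen_lt continuous_const continuous_fst).inter
    ((isOpen_lt continuous_const continuous_snd).inter
      (isOpen_lt (continuous_fst.add continuous_snd) continuous_const))

lemma isClosed_T2 : IsClosed T2 := by
  unfold T2
  exact (isClosed_le continuous_const continuous_fst).inter
    ((isClosed_le continuous_const continuous_snd).inter
      (isClosed_le (continuous_fst.add continuous_snd) continuous_const))

lemma isCompact_T2 : IsCompact T2 := by
  refine (isCompact_Icc (a := ((0 : ℝ), (0 : ℝ))) (b := ((1 : ℝ), (1 : ℝ)))).of_isClosed_subset
    isClosed_T2 ?_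
  rintro ⟨u, v⟩ ⟨h1, h2, h3⟩
  simp only at h1 h2 h3
  refine ⟨⟨h1, h2⟩, ⟨?_, ?_⟩⟩ <;> simp only <;> linarith

lemma O2_sub_T2 : O2 ⊆ T2 := fun _ h => ⟨h.1.le, h.2.1.le, h.2.2.le⟩

lemma T2_ae_O2 : T2 =ᵐ[volume] O2 := by
  have h0 : volume (T2 \ O2) = 0 := by
    rw [Measure.volume_eq_prod,
      Measure.measure_prod_null (isClosed_T2.measurableSet.diff isOpen_O2.measurableSet)]
    have : ∀ᵐ u : ℝ, u ≠ 0 := by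
      simp [ae_iff]
    filter_upwards [this] with u hu
    refine measure_mono_null (t := {0, 1 - u}) ?_ ((Set.toFinite _).measure_zero _)
    rintro v ⟨⟨h1, h2, h3⟩, h4⟩
    simp only [O2, Set.mem_ofPred_eq, not_and, not_lt] at h1 h2 h3 h4
    by_cases hv : v = 0
    · left; exact hv
    · right
      have := h4 (lt_of_le_of_ne h1 (Ne.symm hu)) (lt_of_le_of_ne h2 (Ne.symm hv))
      simp only [Set.mem_singleton_iff]; linarith
  exact (ae_le_set.mpr h0).antisymm (LE.le.eventuallyLE O2_sub_T2)

lemma beta1d {b c s : ℝ} (hb : -1 < b) (hc : -1 < c) (hs : 0 < s) :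
    IntegrableOn (fun v : ℝ => v ^ b * (s - v) ^ c) (Set.Ioo 0 s) ∧
    ∫ v in Set.Ioo 0 s, v ^ b * (s - v) ^ c
      = s ^ (b + c + 1) * ProbabilityTheory.beta (b + 1) (c + 1) := by
  have hB := ProbabilityTheory.beta_pos (α := b + 1) (β := c + 1) (by linarith) (by linarith)
  have key : ∫ v in Set.Ioo 0 s, v ^ b * (s - v) ^ c
      = s ^ (b + c + 1) * ProbabilityTheory.beta (b + 1) (c + 1) := by
    have h := Complex.betaIntegral_scaled ((b + 1 : ℝ) : ℂ) ((c + 1 : ℝ) : ℂ) hs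
    rw [intervalIntegral.integral_of_le hs.le, integral_Ioc_eq_integral_Ioo] at h
    have e : ∫ (x : ℝ) in Set.Ioo 0 s, (x : ℂ) ^ (((b + 1 : ℝ) : ℂ) - 1)
          * ((s : ℂ) - x) ^ (((c + 1 : ℝ) : ℂ) - 1)
        = ∫ v in Set.Ioo 0 s, ((v ^ b * (s - v) ^ c : ℝ) : ℂ) := by
      refine setIntegral_congr_fun measurableSet_Ioo fun v hv => ?_
      have h1 : (0 : ℝ) ≤ v := hv.1.le
      have h2 : (0 : ℝ) ≤ s - v := by linarith [hv.2]
      rw [Complex.ofReal_mul, Complex.ofReal_cpow h1, Complex.ofReal_cpow h2]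
      push_cast
      simp
    rw [e, integral_complex_ofReal] at h
    have h' := congrArg Complex.re h
    rw [show (((b + 1 : ℝ) : ℂ) + ((c + 1 : ℝ) : ℂ) - 1) = ((b + c + 1 : ℝ) : ℂ) by push_cast; ring,
      ← Complex.ofReal_cpow hs.le, Complex.re_ofReal_mul,
      ← ProbabilityTheory.beta_eq_betaIntegralReal _ _ (by linarith) (by linarith)] at h'
    simpa using h'
  refine ⟨?_, key⟩
  by_contra hcon
  rw [integral_undef hcon] at key
  have := mul_pos (Real.rpow_pos_of_pos hs (b + c + 1)) hB
  linarith

lemma O2_slice_in {u : ℝ} (hu : u ∈ Set.Ioo (0:ℝ) 1) (h : ℝ × ℝ → ℝ) :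
    (fun v => O2.indicator h (u, v)) = (Set.Ioo 0 (1 - u)).indicator (fun v => h (u, v)) := by
  funext v
  by_cases hv : v ∈ Set.Ioo 0 (1 - u)
  · rw [Set.indicator_of_mem hv, Set.indicator_of_mem]
    exact ⟨hu.1, hv.1, by simp only; linarith [hv.2]⟩
  · rw [Set.indicator_of_notMem hv, Set.indicator_of_notMem]
    rintro ⟨h1, h2, h3⟩
    exact hv ⟨h2, by simp only at h3; linarith⟩

lemma O2_slice_out {u : ℝ} (hu : u ∉ Set.Ioo (0:ℝ) 1) (h : ℝ × ℝ → ℝ) :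
    (fun v => O2.indicator h (u, v)) = fun _ => 0 := by
  funext v
  rw [Set.indicator_of_notMem]
  rintro ⟨h1, h2, h3⟩
  simp only at h1 h2 h3
  exact hu ⟨h1, by linarith⟩

lemma measurable_ww (a b c : ℝ) : Measurable (fun p => ww p a b c) := by
  unfold ww
  fun_prop

lemma ww_inner {a b c u : ℝ} (hb : -1 < b) (hc : -1 < c) :
    Integrable (fun v => O2.indicator (fun p => ww p a b c) (u, v)) ∧
    ∫ v, O2.indicator (fun p => ww p a b c) (u, v) = (Set.Ioo 0 1).indicator (fun u =>
      u ^ a * (1 - u) ^ (b + c + 1) * ProbabilityTheory.beta (b + 1) (c + 1)) u := by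
  by_cases hu : u ∈ Set.Ioo (0:ℝ) 1
  · rw [O2_slice_in hu, Set.indicator_of_mem hu]
    have h := beta1d hb hc (s := 1 - u) (by linarith [hu.2])
    constructor
    · rw [integrable_indicator_iff measurableSet_Ioo]
      refine (h.1.const_mul (u ^ a)).congr ?_
      filter_upwards with v
      simp [ww, mul_assoc]
    · rw [integral_indicator measurableSet_Ioo]
      simp only [ww, mul_assoc]
      rw [integral_const_mul, h.2]
  · rw [O2_slice_out hu, Set.indicator_of_notMem hu]
    simp

lemma ww_int {a b c : ℝ} (ha : -1 < a) (hb : -1 < b) (hc : -1 < c) :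
    IntegrableOn (fun p => ww p a b c) O2 := by
  rw [← integrable_indicator_iff isOpen_O2.measurableSet, Measure.volume_eq_prod,
    integrable_prod_iff]
  · refine ⟨ae_of_all _ fun u => (ww_inner hb hc).1, ?_⟩
    have : ∀ u v, ‖O2.indicator (fun p => ww p a b c) (u, v)‖
        = O2.indicator (fun p => ww p a b c) (u, v) := by
      intro u v
      rw [Real.norm_eq_abs, abs_of_nonneg]
      refine Set.indicator_nonneg ?_ _
      rintro p ⟨h1, h2, h3⟩
      have : 0 < 1 - p.1 - p.2 := by linarith
      unfold ww
      positivity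
    simp_rw [this, (ww_inner hb hc).2]
    rw [integrable_indicator_iff measurableSet_Ioo]
    exact (beta1d ha (by linarith : -1 < b + c + 1) one_pos).1.mul_const _
  · exact ((measurable_ww a b c).indicator isOpen_O2.measurableSet).aestronglyMeasurable

lemma ww_integral {a b c : ℝ} (ha : -1 < a) (hb : -1 < b) (hc : -1 < c) :
    ∫ p in O2, ww p a b c = Beta3 (a + 1) (b + 1) (c + 1) := by
  have hi := ww_int ha hb hc
  rw [← integrable_indicator_iff isOpen_O2.measurableSet] at hi
  rw [← integral_indicator isOpen_O2.measurableSet]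
  rw [Measure.volume_eq_prod] at hi ⊢
  rw [integral_prod _ hi]
  simp_rw [(ww_inner hb hc).2]
  rw [integral_indicator measurableSet_Ioo, integral_mul_const,
    (beta1d ha (by linarith : -1 < b + c + 1) one_pos).2]
  have h1 := (Real.Gamma_pos_of_pos (show 0 < b + 1 + (c + 1) by linarith)).ne'
  have h2 := (Real.Gamma_pos_of_pos (show 0 < a + 1 + (b + 1) + (c + 1) by linarith)).ne'
  simp only [Beta3, ProbabilityTheory.beta, Real.one_rpow, one_mul]
  rw [show b + c + 1 + 1 = b + 1 + (c + 1) by ring,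
    show a + 1 + (b + 1 + (c + 1)) = a + 1 + (b + 1) + (c + 1) by ring]
  field_simp

noncomputable def JJ (F : ℝ × ℝ → ℝ) (a b c : ℝ) : ℝ := ∫ p in O2, F p * ww p a b c

lemma F_int {F : ℝ × ℝ → ℝ} (hF : ContinuousOn F T2) {a b c : ℝ}
    (ha : -1 < a) (hb : -1 < b) (hc : -1 < c) :
    IntegrableOn (fun p => F p * ww p a b c) O2 := by
  have h1 : IntegrableOn (fun p => ww p a b c) T2 := (ww_int ha hb hc).congr_set_ae T2_ae_O2
  exact (h1.continuousOn_mul hF isCompact_T2).mono_set O2_sub_T2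

lemma ww_deriv_v {p : ℝ × ℝ} (hp : p ∈ O2) (a b c : ℝ) :
    HasDerivAt (fun t => ww (p.1, t) a b c) (opB (ww p) a b c) p.2 := by
  obtain ⟨h1, h2, h3⟩ := hp
  have e1 : HasDerivAt (fun t : ℝ => t ^ b) (b * p.2 ^ (b - 1)) p.2 :=
    Real.hasDerivAt_rpow_const (Or.inl h2.ne')
  have e2 : HasDerivAt (fun t : ℝ => 1 - p.1 - t) (-1) p.2 := by
    simpa using (hasDerivAt_id p.2).const_sub (1 - p.1)
  have e3 := e2.rpow_const (p := c) (Or.inl (by linarith))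
  have := (e1.const_mul (p.1 ^ a)).mul e3
  refine this.congr_deriv ?_
  simp only [opB, ww]
  ring

lemma ww_deriv_u {p : ℝ × ℝ} (hp : p ∈ O2) (a b c : ℝ) :
    HasDerivAt (fun s => ww (s, p.2) a b c) (opA (ww p) a b c) p.1 := by
  obtain ⟨h1, h2, h3⟩ := hp
  have e1 : HasDerivAt (fun t : ℝ => t ^ a) (a * p.1 ^ (a - 1)) p.1 :=
    Real.hasDerivAt_rpow_const (Or.inl h1.ne')
  have e2 : HasDerivAt (fun t : ℝ => 1 - t - p.2) (-1) p.1 := by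
    simpa using ((hasDerivAt_id p.1).const_sub 1).sub_const p.2
  have e3 := e2.rpow_const (p := c) (Or.inl (by linarith))
  have := (e1.mul_const (p.2 ^ b)).mul e3
  refine this.congr_deriv ?_
  simp only [opA, ww]
  ring

lemma ibpB {F F' : ℝ × ℝ → ℝ} (hF : ContinuousOn F T2) (hF' : ContinuousOn F' T2)
    (hd : ∀ p ∈ O2, HasDerivAt (fun t => F (p.1, t)) (F' p) p.2) {a b c : ℝ}
    (ha : -1 < a) (hb : 0 < b) (hc : 0 < c) :
    opB (JJ F) a b c = - JJ F' a b c := by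
  have i1 := F_int hF ha (by linarith : -1 < b - 1) (by linarith : -1 < c)
  have i2 := F_int hF ha (by linarith : -1 < b) (by linarith : -1 < c - 1)
  have i3 := F_int hF' ha (by linarith : -1 < b) (by linarith : -1 < c)
  set h : ℝ × ℝ → ℝ := fun p => b * (F p * ww p a (b - 1) c) - c * (F p * ww p a b (c - 1))
    + F' p * ww p a b c with hh
  have i12 : Integrable (fun p => b * (F p * ww p a (b - 1) c) - c * (F p * ww p a b (c - 1)))
      (volume.restrict O2) := (i1.const_mul b).sub (i2.const_mul c)
  have hi : IntegrableOn h O2 := i12.add i3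
  have e : ∫ p in O2, h p = opB (JJ F) a b c + JJ F' a b c := by
    rw [hh, integral_add i12 i3, integral_sub (i1.const_mul b) (i2.const_mul c),
      integral_const_mul, integral_const_mul]
    rfl
  have hz : ∫ p in O2, h p = 0 := by
    rw [← integrable_indicator_iff isOpen_O2.measurableSet] at hi
    rw [← integral_indicator isOpen_O2.measurableSet]
    rw [Measure.volume_eq_prod] at hi ⊢
    rw [integral_prod _ hi]
    rw [integral_eq_zero_of_ae]
    filter_upwards [hi.prod_right_ae] with u hu
    by_cases hu1 : u ∈ Set.Ioo (0:ℝ) 1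
    · rw [O2_slice_in hu1] at hu ⊢
      rw [integrable_indicator_iff measurableSet_Ioo] at hu
      rw [integral_indicator measurableSet_Ioo, ← integral_Ioc_eq_integral_Ioo,
        ← intervalIntegral.integral_of_le (by linarith [hu1.2])]
      have hc1 : ContinuousOn (fun v => F (u, v) * ww (u, v) a b c) (Set.Icc 0 (1 - u)) := by
        refine ContinuousOn.mul ?_ ?_
        · refine hF.comp (by fun_prop) ?_
          rintro v ⟨hv1, hv2⟩
          exact ⟨hu1.1.le, hv1, by simp only; linarith⟩
        · simp only [ww]
          refine ContinuousOn.mul (ContinuousOn.mul continuousOn_const ?_) ?_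
          · exact ContinuousOn.rpow_const continuousOn_id fun _ _ => Or.inr hb.le
          · exact ContinuousOn.rpow_const (by fun_prop) fun _ _ => Or.inr hc.le
      have := intervalIntegral.integral_eq_sub_of_hasDerivAt_of_le (by linarith [hu1.2]) hc1
        (f' := fun v => h (u, v)) ?_ ?_
      · rw [this]
        simp [ww, Real.zero_rpow hb.ne', Real.zero_rpow hc.ne']
      · rintro v ⟨hv1, hv2⟩
        have hp : (u, v) ∈ O2 := ⟨hu1.1, hv1, by simp only; linarith⟩
        refine ((hd _ hp).mul (ww_deriv_v hp a b c)).congr_deriv ?_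
        simp only [hh, opB]
        ring
      · rw [intervalIntegrable_iff_integrableOn_Ioo_of_le (by linarith [hu1.2])]
        exact hu
    · rw [O2_slice_out hu1]
      simp
  linarith

lemma ww_swap (q : ℝ × ℝ) (a b c : ℝ) : ww q.swap a b c = ww q b a c := by
  simp only [ww, Prod.fst_swap, Prod.snd_swap]
  rw [show 1 - q.2 - q.1 = 1 - q.1 - q.2 by ring]
  ring

lemma O2_swap (q : ℝ × ℝ) : q.swap ∈ O2 ↔ q ∈ O2 := by
  simp only [O2, Set.mem_ofPred_eq, Prod.fst_swap, Prod.snd_swap]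
  rw [add_comm]; tauto

lemma T2_swap {q : ℝ × ℝ} (h : q ∈ T2) : q.swap ∈ T2 :=
  ⟨h.2.1, h.1, by simpa [add_comm] using h.2.2⟩

lemma JJ_swap (F : ℝ × ℝ → ℝ) (a b c : ℝ) : JJ (F ∘ Prod.swap) a b c = JJ F b a c := by
  have h := (Measure.measurePreserving_swap (μ := (volume : Measure ℝ))
    (ν := (volume : Measure ℝ))).setIntegral_preimage_emb
      MeasurableEquiv.prodComm.measurableEmbedding (fun p => F p * ww p b a c) O2
  have e : Prod.swap ⁻¹' O2 = O2 := Set.ext O2_swap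
  rw [e] at h
  simp only [ww_swap] at h
  exact h

lemma ibpA {F F' : ℝ × ℝ → ℝ} (hF : ContinuousOn F T2) (hF' : ContinuousOn F' T2)
    (hd : ∀ p ∈ O2, HasDerivAt (fun s => F (s, p.2)) (F' p) p.1) {a b c : ℝ}
    (ha : 0 < a) (hb : -1 < b) (hc : 0 < c) :
    opA (JJ F) a b c = - JJ F' a b c := by
  have := ibpB (F := F ∘ Prod.swap) (F' := F' ∘ Prod.swap)
    (hF.comp continuous_swap.continuousOn fun _ h => T2_swap h)
    (hF'.comp continuous_swap.continuousOn fun _ h => T2_swap h)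
    (fun p hp => hd p.swap ((O2_swap p).2 hp)) hb ha hc
  simpa only [opA, opB, JJ_swap] using this

lemma smooth_v {V : Set (ℝ × ℝ)} (hV : IsOpen V) {m : ℕ} {G : ℝ × ℝ → ℝ}
    (hG : ContDiffOn ℝ (m + 1 : ℕ) G V) :
    ContDiffOn ℝ m (fun p => deriv (fun t => G (p.1, t)) p.2) V ∧
    ∀ p ∈ V, HasDerivAt (fun t => G (p.1, t)) (deriv (fun t => G (p.1, t)) p.2) p.2 := by
  have key : ∀ p ∈ V, HasDerivAt (fun t => G (p.1, t)) (fderiv ℝ G p (0, 1)) p.2 := by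
    intro p hp
    have h1 : DifferentiableAt ℝ G p :=
      (hG.differentiableOn (by simp)).differentiableAt (hV.mem_nhds hp)
    have h2 : HasDerivAt (fun t : ℝ => (p.1, t)) ((0 : ℝ), (1 : ℝ)) p.2 :=
      (hasDerivAt_const _ _).prodMk (hasDerivAt_id _)
    exact (h1.hasFDerivAt : HasFDerivAt G (fderiv ℝ G p) (p.1, p.2)).comp_hasDerivAt p.2 h2
  refine ⟨?_, fun p hp => (key p hp).differentiableAt.hasDerivAt⟩
  have h := hG.fderiv_of_isOpen hV (m := m) (by norm_cast)
  exact (h.clm_apply contDiffOn_const).congr fun p hp => (key p hp).deriv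

lemma smooth_u {V : Set (ℝ × ℝ)} (hV : IsOpen V) {m : ℕ} {G : ℝ × ℝ → ℝ}
    (hG : ContDiffOn ℝ (m + 1 : ℕ) G V) :
    ContDiffOn ℝ m (fun p => deriv (fun s => G (s, p.2)) p.1) V ∧
    ∀ p ∈ V, HasDerivAt (fun s => G (s, p.2)) (deriv (fun s => G (s, p.2)) p.1) p.1 := by
  have key : ∀ p ∈ V, HasDerivAt (fun s => G (s, p.2)) (fderiv ℝ G p (1, 0)) p.1 := by
    intro p hp
    have h1 : DifferentiableAt ℝ G p :=
      (hG.differentiableOn (by simp)).differentiableAt (hV.mem_nhds hp)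
    have h2 : HasDerivAt (fun t : ℝ => (t, p.2)) ((1 : ℝ), (0 : ℝ)) p.1 :=
      (hasDerivAt_id _).prodMk (hasDerivAt_const _ _)
    exact (h1.hasFDerivAt : HasFDerivAt G (fderiv ℝ G p) (p.1, p.2)).comp_hasDerivAt p.1 h2
  refine ⟨?_, fun p hp => (key p hp).differentiableAt.hasDerivAt⟩
  have h := hG.fderiv_of_isOpen hV (m := m) (by norm_cast)
  exact (h.clm_apply contDiffOn_const).congr fun p hp => (key p hp).deriv

/-- uncurried partial derivative -/
noncomputable def PD (k l : ℕ) (F : ℝ × ℝ → ℝ) (p : ℝ × ℝ) : ℝ :=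
  pderiv2 k l (fun s t => F (s, t)) p.1 p.2

lemma PD_zero (F : ℝ × ℝ → ℝ) : PD 0 0 F = F := by
  funext p; simp [PD, pderiv2]

lemma PD_succ_v (l : ℕ) (F : ℝ × ℝ → ℝ) :
    PD 0 (l + 1) F = fun p => deriv (fun t => PD 0 l F (p.1, t)) p.2 := by
  funext p; simp [PD, pderiv2, iteratedDeriv_succ]

lemma PD_succ_u (k l : ℕ) (F : ℝ × ℝ → ℝ) :
    PD (k + 1) l F = fun p => deriv (fun s => PD k l F (s, p.2)) p.1 := by
  funext p; simp [PD, pderiv2, iteratedDeriv_succ]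

lemma PD_smooth_v {V : Set (ℝ × ℝ)} (hV : IsOpen V) {F : ℝ × ℝ → ℝ} (l : ℕ) :
    ∀ m : ℕ, ContDiffOn ℝ (m + l : ℕ) F V → ContDiffOn ℝ m (PD 0 l F) V := by
  induction l with
  | zero => intro m h; rw [PD_zero]; exact h
  | succ l ih =>
    intro m h
    rw [PD_succ_v]
    exact (smooth_v hV (ih (m + 1) (by rwa [show m + 1 + l = m + (l + 1) by ring]))).1

lemma PD_smooth {V : Set (ℝ × ℝ)} (hV : IsOpen V) {F : ℝ × ℝ → ℝ} (k l : ℕ) :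
    ∀ m : ℕ, ContDiffOn ℝ (m + k + l : ℕ) F V → ContDiffOn ℝ m (PD k l F) V := by
  induction k with
  | zero => intro m h; exact PD_smooth_v hV l m h
  | succ k ih =>
    intro m h
    rw [PD_succ_u]
    exact (smooth_u hV (ih (m + 1) (by rwa [show m + 1 + k + l = m + (k + 1) + l by ring]))).1

lemma JJ_opB {V : Set (ℝ × ℝ)} (hV : IsOpen V) (hTV : T2 ⊆ V) {F : ℝ × ℝ → ℝ} (l : ℕ) :
    ContDiffOn ℝ (l : ℕ) F V → ∀ a b c : ℝ, -1 < a → (l : ℝ) - 1 < b → (l : ℝ) - 1 < c →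
    opB^[l] (JJ F) a b c = (-1) ^ l * JJ (PD 0 l F) a b c := by
  induction l with
  | zero => intro h a b c _ _ _; simp [PD_zero]
  | succ l ih =>
    intro h a b c ha hb hc
    push_cast at hb hc
    have hl : (0 : ℝ) ≤ l := Nat.cast_nonneg l
    have h' : ContDiffOn ℝ (l : ℕ) F V := h.of_le (by norm_cast; simp)
    rw [Function.iterate_succ_apply', opB, ih h' a (b - 1) c ha (by linarith) (by linarith),
      ih h' a b (c - 1) ha (by linarith) (by linarith)]
    have s0 := PD_smooth_v hV l 1 (by rwa [add_comm])
    have s1 := smooth_v hV (m := 0) s0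
    have := ibpB (F := PD 0 l F) (F' := PD 0 (l + 1) F) (s0.continuousOn.mono hTV)
      (by rw [PD_succ_v]; exact s1.1.continuousOn.mono hTV)
      (by rw [PD_succ_v]; exact fun p hp => s1.2 p (hTV (O2_sub_T2 hp))) (c := c) ha
      (by linarith : 0 < b) (by linarith)
    rw [pow_succ, mul_assoc, neg_one_mul, ← this, opB]
    ring

lemma JJ_opA {V : Set (ℝ × ℝ)} (hV : IsOpen V) (hTV : T2 ⊆ V) {F : ℝ × ℝ → ℝ} (l k : ℕ) :
    ContDiffOn ℝ (k + l : ℕ) F V → ∀ a b c : ℝ, (k : ℝ) - 1 < a → (l : ℝ) - 1 < b →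
    (k : ℝ) + l - 1 < c →
    opA^[k] (opB^[l] (JJ F)) a b c = (-1) ^ (k + l) * JJ (PD k l F) a b c := by
  induction k with
  | zero =>
    intro h a b c h1 h2 h3
    simpa using JJ_opB hV hTV l (by simpa using h) a b c (by simpa using h1) h2 (by simpa using h3)
  | succ k ih =>
    intro h a b c ha hb hc
    push_cast at ha hc
    have hl : (0 : ℝ) ≤ l := Nat.cast_nonneg l
    have hk : (0 : ℝ) ≤ k := Nat.cast_nonneg k
    have h' : ContDiffOn ℝ (k + l : ℕ) F V := h.of_le (by norm_cast; omega)
    rw [Function.iterate_succ_apply', opA, ih h' (a - 1) b c (by linarith) (by linarith)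
      (by linarith), ih h' a b (c - 1) (by linarith) (by linarith) (by linarith)]
    have s0 := PD_smooth hV k l 1 (by rwa [add_comm 1 k])
    have s1 := smooth_u hV (m := 0) s0
    have := ibpA (F := PD k l F) (F' := PD (k + 1) l F) (s0.continuousOn.mono hTV)
      (by rw [PD_succ_u]; exact s1.1.continuousOn.mono hTV)
      (by rw [PD_succ_u]; exact fun p hp => s1.2 p (hTV (O2_sub_T2 hp))) (c := c)
      (by linarith : 0 < a) (by linarith : -1 < b) (by linarith)
    rw [show k + 1 + l = k + l + 1 by ring, pow_succ, mul_assoc, neg_one_mul, ← this, opA]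
    ring

lemma opB_iter_deriv_v (l : ℕ) {p : ℝ × ℝ} (hp : p ∈ O2) : ∀ a b c : ℝ,
    HasDerivAt (fun t => opB^[l] (ww (p.1, t)) a b c) (opB^[l + 1] (ww p) a b c) p.2 := by
  induction l with
  | zero => intro a b c; exact ww_deriv_v hp a b c
  | succ l ih =>
    intro a b c
    rw [Function.iterate_succ_apply' opB (l + 1)]
    conv => enter [1, t]; rw [Function.iterate_succ_apply' opB l]
    exact ((ih a (b - 1) c).const_mul b).sub ((ih a b (c - 1)).const_mul c)

lemma opB_iter_deriv_u (l : ℕ) {p : ℝ × ℝ} (hp : p ∈ O2) : ∀ a b c : ℝ,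
    HasDerivAt (fun s => opB^[l] (ww (s, p.2)) a b c) (opA (opB^[l] (ww p)) a b c) p.1 := by
  induction l with
  | zero => intro a b c; exact ww_deriv_u hp a b c
  | succ l ih =>
    intro a b c
    simp only [Function.iterate_succ_apply' opB l]
    rw [opA_opB]
    exact ((ih a (b - 1) c).const_mul b).sub ((ih a b (c - 1)).const_mul c)

lemma opA_iter_deriv_u (k l : ℕ) {p : ℝ × ℝ} (hp : p ∈ O2) : ∀ a b c : ℝ,
    HasDerivAt (fun s => opA^[k] (opB^[l] (ww (s, p.2))) a b c)
      (opA^[k + 1] (opB^[l] (ww p)) a b c) p.1 := by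
  induction k with
  | zero => intro a b c; exact opB_iter_deriv_u l hp a b c
  | succ k ih =>
    intro a b c
    rw [Function.iterate_succ_apply' opA (k + 1)]
    conv => enter [1, t]; rw [Function.iterate_succ_apply' opA k]
    exact ((ih (a - 1) b c).const_mul a).sub ((ih a b (c - 1)).const_mul c)

lemma PD_ww_v (l : ℕ) (a b c : ℝ) : ∀ p ∈ O2,
    PD 0 l (fun q => ww q a b c) p = opB^[l] (ww p) a b c := by
  induction l with
  | zero => intro p _; rw [PD_zero]; rfl
  | succ l ih =>
    intro p hp
    rw [PD_succ_v, ← (opB_iter_deriv_v l hp a b c).deriv]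
    refine Filter.EventuallyEq.deriv_eq ?_
    have : ∀ᶠ t in nhds p.2, (p.1, t) ∈ O2 :=
      (Continuous.prodMk_right p.1).continuousAt.eventually_mem (isOpen_O2.mem_nhds hp)
    filter_upwards [this] with t ht using ih _ ht

lemma PD_ww (k l : ℕ) (a b c : ℝ) : ∀ p ∈ O2,
    PD k l (fun q => ww q a b c) p = opA^[k] (opB^[l] (ww p)) a b c := by
  induction k with
  | zero => exact PD_ww_v l a b c
  | succ k ih =>
    intro p hp
    rw [PD_succ_u, ← (opA_iter_deriv_u k l hp a b c).deriv]
    refine Filter.EventuallyEq.deriv_eq ?_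
    have : ∀ᶠ t in nhds p.1, (t, p.2) ∈ O2 :=
      (Continuous.prodMk_left p.2).continuousAt.eventually_mem (isOpen_O2.mem_nhds hp)
    filter_upwards [this] with t ht using ih _ ht

/-- `M` represents integration of `F * Ψ` on exponents above the thresholds. -/
def RepI (F : ℝ × ℝ → ℝ) (Ψ : ℝ × ℝ → ℝ → ℝ → ℝ → ℝ) (M : ℝ → ℝ → ℝ → ℝ) (a0 b0 c0 : ℝ) : Prop :=
  ∀ a b c, a0 < a → b0 < b → c0 < c →
    IntegrableOn (fun p => F p * Ψ p a b c) O2 ∧ ∫ p in O2, F p * Ψ p a b c = M a b c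

lemma RepI.opB {F Ψ M a0 b0 c0} (h : RepI F Ψ M a0 b0 c0) :
    RepI F (fun p => opB (Ψ p)) (opB M) a0 (b0 + 1) (c0 + 1) := by
  intro a b c ha hb hc
  obtain ⟨i1, e1⟩ := h a (b - 1) c ha (by linarith) (by linarith)
  obtain ⟨i2, e2⟩ := h a b (c - 1) ha (by linarith) (by linarith)
  have e : (fun p => F p * _root_.opB (Ψ p) a b c)
      = fun p => b * (F p * Ψ p a (b - 1) c) - c * (F p * Ψ p a b (c - 1)) := by
    funext p; simp only [_root_.opB]; ring
  rw [e]
  refine ⟨(i1.const_mul b).sub (i2.const_mul c), ?_⟩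
  rw [integral_sub (i1.const_mul b) (i2.const_mul c), integral_const_mul, integral_const_mul,
    e1, e2, _root_.opB]

lemma RepI.opA {F Ψ M a0 b0 c0} (h : RepI F Ψ M a0 b0 c0) :
    RepI F (fun p => opA (Ψ p)) (opA M) (a0 + 1) b0 (c0 + 1) := by
  intro a b c ha hb hc
  obtain ⟨i1, e1⟩ := h (a - 1) b c (by linarith) (by linarith) (by linarith)
  obtain ⟨i2, e2⟩ := h a b (c - 1) (by linarith) (by linarith) (by linarith)
  have e : (fun p => F p * _root_.opA (Ψ p) a b c)
      = fun p => a * (F p * Ψ p (a - 1) b c) - c * (F p * Ψ p a b (c - 1)) := by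
    funext p; simp only [_root_.opA]; ring
  rw [e]
  refine ⟨(i1.const_mul a).sub (i2.const_mul c), ?_⟩
  rw [integral_sub (i1.const_mul a) (i2.const_mul c), integral_const_mul, integral_const_mul,
    e1, e2, _root_.opA]

lemma rep_iter {F : ℝ × ℝ → ℝ} (hF : ContinuousOn F T2) (k l : ℕ) :
    RepI F (fun p => opA^[k] (opB^[l] (ww p))) (opA^[k] (opB^[l] (JJ F)))
      (k - 1) (l - 1) (k + l - 1) := by
  induction k with
  | zero =>
    induction l with
    | zero =>
      intro a b c ha hb hc
      refine ⟨F_int hF (by simpa using ha) (by simpa using hb) (by simpa using hc), rfl⟩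
    | succ l ih =>
      have := ih.opB
      simp only [Function.iterate_zero, id_eq, Function.iterate_succ_apply'] at this ⊢
      push_cast at this ⊢
      convert this using 1 <;> ring
  | succ k ih =>
    have := ih.opA
    simp only [Function.iterate_succ_apply'] at this ⊢
    push_cast at this ⊢
    convert this using 1 <;> ring

lemma main_ibp {V : Set (ℝ × ℝ)} (hV : IsOpen V) (hTV : T2 ⊆ V) {F : ℝ × ℝ → ℝ} (k l : ℕ)
    (hF : ContDiffOn ℝ (k + l : ℕ) F V) {α β γ : ℝ} (hα : -1 < α) (hβ : -1 < β) (hγ : -1 < γ) :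
    ∫ p in T2, F p * Ukn α β γ k (k + l) p.1 p.2 * p.1 ^ α * p.2 ^ β * (1 - p.1 - p.2) ^ γ
      = (-1) ^ (k + l) * JJ (PD k l F) (k + α) (l + β) ((k + l : ℕ) + γ) := by
  rw [setIntegral_congr_set T2_ae_O2]
  rw [← JJ_opA hV hTV l k hF _ _ _ (by linarith) (by linarith) (by push_cast; linarith),
    ← (rep_iter (hF.continuousOn.mono hTV) k l _ _ _ (by linarith) (by linarith)
      (by push_cast; linarith)).2]
  refine setIntegral_congr_fun isOpen_O2.measurableSet fun p hp => ?_
  simp only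
  rw [← PD_ww k l _ _ _ p hp, Ukn, PD]
  have h0 : ((k + l : ℕ) : ℝ) - k + β = l + β := by push_cast; ring
  rw [h0, Nat.add_sub_cancel_left]
  have w1 := (Real.rpow_pos_of_pos hp.1 α).ne'
  have w2 := (Real.rpow_pos_of_pos hp.2.1 β).ne'
  have w3 := (Real.rpow_pos_of_pos (show 0 < 1 - p.1 - p.2 by linarith [hp.2.2]) γ).ne'
  simp only [ww]
  field_simp

lemma iteratedDeriv_aff (k : ℕ) (h : ℝ → ℝ) (x δ : ℝ) :
    iteratedDeriv k (fun s => h (x + δ * s)) = fun s => δ ^ k * iteratedDeriv k h (x + δ * s) := by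
  induction k with
  | zero => simp
  | succ k ih =>
    funext s
    rw [iteratedDeriv_succ, ih, iteratedDeriv_succ, deriv_const_mul_field]
    have := deriv_comp_mul_left δ (fun s => iteratedDeriv k h (x + s)) s
    rw [this, deriv_comp_const_add, smul_eq_mul]
    ring

lemma PD_aff (k l : ℕ) (f : ℝ × ℝ → ℝ) (x y δ : ℝ) (p : ℝ × ℝ) :
    PD k l (fun p => f (x + δ * p.1, y + δ * p.2)) p
      = δ ^ (k + l) * PD k l f (x + δ * p.1, y + δ * p.2) := by
  simp only [PD, pderiv2]
  have : (fun s => iteratedDeriv l (fun t => f (x + δ * s, y + δ * t)) p.2)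
      = fun s => δ ^ l * (fun s' => iteratedDeriv l (fun t => f (s', t)) (y + δ * p.2)) (x + δ * s) := by
    funext s
    exact congrFun (iteratedDeriv_aff l (fun t => f (x + δ * s, t)) y δ) p.2
  rw [this, iteratedDeriv_const_mul_field, iteratedDeriv_aff k
    (fun s' => iteratedDeriv l (fun t => f (s', t)) (y + δ * p.2))]
  ring

lemma aff_mem {x y r δ : ℝ} (h0 : 0 < δ) (hr : δ < r) {p : ℝ × ℝ} (hp : p ∈ T2) :
    (x + δ * p.1, y + δ * p.2) ∈ Metric.ball (x, y) r := by
  obtain ⟨h1, h2, h3⟩ := hp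
  rw [Metric.mem_ball, Prod.dist_eq, Real.dist_eq, Real.dist_eq]
  simp only [add_sub_cancel_left]
  rw [abs_of_nonneg (by positivity), abs_of_nonneg (by positivity), max_lt_iff]
  constructor <;> nlinarith

/-- The partial derivative `∂ⁿf/∂xᵏ∂y^{n-k}(x,y)` equals
`(-1)ⁿ/B(α+1+k, β+1+n-k, γ+1+n)` times the limit as `δ ↓ 0` of
`δ^{-n} ∬_{T²} f(x+δu, y+δv) U_{k,n}^{α,β,γ}(u,v) u^α v^β (1-u-v)^γ dv du`. -/
theorem stmt0 (α β γ : ℝ) (hα : -1 < α) (hβ : -1 < β) (hγ : -1 < γ)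
    (k n : ℕ) (hkn : k ≤ n) (f : ℝ × ℝ → ℝ) (x y : ℝ)
    (V : Set (ℝ × ℝ)) (hV : IsOpen V) (hxyV : (x, y) ∈ V)
    (hf : ContDiffOn ℝ n f V) :
    Tendsto
      (fun δ : ℝ =>
        ((-1 : ℝ) ^ n / Beta3 (α + 1 + k) (β + 1 + ((n : ℝ) - (k : ℝ))) (γ + 1 + n)) *
          ((1 / δ ^ n) *
            ∫ p in T2, f (x + δ * p.1, y + δ * p.2) * Ukn α β γ k n p.1 p.2 *
              p.1 ^ α * p.2 ^ β * (1 - p.1 - p.2) ^ γ))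
      (nhdsWithin 0 (Set.Ioi 0))
      (nhds (pderiv2 k (n - k) (fun s t => f (s, t)) x y)) := by
  obtain ⟨l, rfl⟩ := Nat.exists_eq_add_of_le hkn
  obtain ⟨r, hr, hrV⟩ := Metric.isOpen_iff.1 hV _ hxyV
  have hH : ContinuousOn (PD k l f) V :=
    (PD_smooth hV k l 0 (by simpa using hf)).continuousOn
  have hHc : ContinuousAt (PD k l f) (x, y) := hH.continuousAt (hV.mem_nhds hxyV)
  obtain ⟨r', hr', hb⟩ : ∃ r' > 0, ∀ q ∈ Metric.ball (x, y) r',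
      ‖PD k l f q‖ ≤ ‖PD k l f (x, y)‖ + 1 := by
    have : ∀ᶠ q in nhds (x, y), ‖PD k l f q‖ < ‖PD k l f (x, y)‖ + 1 :=
      hHc.norm.eventually_lt continuousAt_const (by linarith)
    obtain ⟨r', h1, h2⟩ := Metric.eventually_nhds_iff_ball.1 this
    exact ⟨r', h1, fun q hq => (h2 q hq).le⟩
  have ha : (-1 : ℝ) < k + α := by have := Nat.cast_nonneg (α := ℝ) k; linarith
  have hb' : (-1 : ℝ) < l + β := by have := Nat.cast_nonneg (α := ℝ) l; linarith
  have hc : (-1 : ℝ) < (k + l : ℕ) + γ := by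
    have := Nat.cast_nonneg (α := ℝ) (k + l); linarith
  have hcont : ∀ δ : ℝ, Continuous (fun p : ℝ × ℝ => (x + δ * p.1, y + δ * p.2)) := by
    intro δ; fun_prop
  -- the limit of the weighted averages
  have hlim : Tendsto (fun δ : ℝ => JJ (fun p => PD k l f (x + δ * p.1, y + δ * p.2))
      (k + α) (l + β) ((k + l : ℕ) + γ)) (nhdsWithin 0 (Set.Ioi 0))
      (nhds (∫ p in O2, PD k l f (x, y) * ww p (k + α) (l + β) ((k + l : ℕ) + γ))) := by
    unfold JJ
    refine tendsto_integral_filter_of_dominated_convergence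
      (fun p => (‖PD k l f (x, y)‖ + 1) * ‖ww p (k + α) (l + β) ((k + l : ℕ) + γ)‖) ?_ ?_ ?_ ?_
    · filter_upwards [Ioo_mem_nhdsGT hr] with δ hδ
      refine (F_int ?_ ha hb' hc).aestronglyMeasurable
      exact hH.comp (hcont δ).continuousOn fun p hp => hrV (aff_mem hδ.1 hδ.2 hp)
    · filter_upwards [Ioo_mem_nhdsGT hr'] with δ hδ
      filter_upwards [ae_restrict_mem isOpen_O2.measurableSet] with p hp
      rw [norm_mul]
      exact mul_le_mul_of_nonneg_right (hb _ (aff_mem hδ.1 hδ.2 (O2_sub_T2 hp))) (norm_nonneg _)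
    · exact (ww_int ha hb' hc).norm.const_mul _
    · refine ae_of_all _ fun p => ?_
      refine Tendsto.mul_const _ ?_
      have h1 : Tendsto (fun δ : ℝ => (x + δ * p.1, y + δ * p.2)) (nhds 0) (nhds (x, y)) := by
        have : Continuous (fun δ : ℝ => (x + δ * p.1, y + δ * p.2)) := by fun_prop
        simpa using this.tendsto 0
      exact (hHc.tendsto.comp h1).mono_left nhdsWithin_le_nhds
  rw [integral_const_mul, ww_integral ha hb' hc] at hlim
  have hB : Beta3 (k + α + 1) (l + β + 1) ((k + l : ℕ) + γ + 1) ≠ 0 := by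
    have g1 := Real.Gamma_pos_of_pos (show 0 < k + α + 1 by linarith)
    have g2 := Real.Gamma_pos_of_pos (show 0 < l + β + 1 by linarith)
    have g3 := Real.Gamma_pos_of_pos (show 0 < ((k + l : ℕ) : ℝ) + γ + 1 by linarith)
    have g4 := Real.Gamma_pos_of_pos
      (show 0 < k + α + 1 + (l + β + 1) + (((k + l : ℕ) : ℝ) + γ + 1) by linarith)
    unfold Beta3
    positivity
  have hBe : Beta3 (α + 1 + k) (β + 1 + (((k + l : ℕ) : ℝ) - (k : ℝ))) (γ + 1 + (k + l : ℕ))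
      = Beta3 (k + α + 1) (l + β + 1) ((k + l : ℕ) + γ + 1) := by
    congr 1 <;> push_cast <;> ring
  rw [hBe, Nat.add_sub_cancel_left]
  have hfin := hlim.const_mul (Beta3 (k + α + 1) (l + β + 1) ((k + l : ℕ) + γ + 1))⁻¹
  have hval : (Beta3 (k + α + 1) (l + β + 1) ((k + l : ℕ) + γ + 1))⁻¹ * (PD k l f (x, y) *
      Beta3 (k + α + 1) (l + β + 1) ((k + l : ℕ) + γ + 1))
      = pderiv2 k l (fun s t => f (s, t)) x y := by
    rw [mul_comm, mul_assoc, mul_inv_cancel₀ hB, mul_one]; rfl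
  rw [hval] at hfin
  refine hfin.congr' ?_
  filter_upwards [Ioo_mem_nhdsGT hr] with δ hδ
  have hm := main_ibp (F := fun p => f (x + δ * p.1, y + δ * p.2)) (hV.preimage (hcont δ))
    (fun p hp => hrV (aff_mem hδ.1 hδ.2 hp)) k l
    (hf.comp (by fun_prop) (fun p hp => hp)) hα hβ hγ
  rw [hm]
  have hJ : JJ (PD k l (fun p => f (x + δ * p.1, y + δ * p.2))) (k + α) (l + β) ((k + l : ℕ) + γ)
      = δ ^ (k + l) * JJ (fun p => PD k l f (x + δ * p.1, y + δ * p.2))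
        (k + α) (l + β) ((k + l : ℕ) + γ) := by
    unfold JJ
    rw [← integral_const_mul]
    simp only [PD_aff, mul_assoc]
  rw [hJ]
  have hδ0 : δ ^ (k + l) ≠ 0 := pow_ne_zero _ hδ.1.ne'
  have hs : (-1 : ℝ) ^ (k + l) * (-1) ^ (k + l) = 1 := by rw [← mul_pow]; simp
  generalize JJ (fun p => PD k l f (x + δ * p.1, y + δ * p.2))
    (k + α) (l + β) ((k + l : ℕ) + γ) = Q
  generalize Beta3 (k + α + 1) (l + β + 1) ((k + l : ℕ) + γ + 1) = R
  generalize (-1 : ℝ) ^ (k + l) = e at hs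
  generalize δ ^ (k + l) = d at hδ0
  calc R⁻¹ * Q = (e * e) * (d⁻¹ * d) * (R⁻¹ * Q) := by rw [hs, inv_mul_cancel₀ hδ0]; ring
    _ = _ := by rw [one_div, div_eq_mul_inv]; ring
end

section
/- Let 0 ≤ k ≤ n be integers, α,β,γ > -1 real, and (x,y) with x > 0, y > 0, x+y < 1. Then U_{k,n}^{α,β,γ}(x,y) = (α+1)_k (β+1)_{n-k} (1-x-y)^{-γ} · F₂(-γ-n; α+1+k, β+1+n-k; α+1, β+1; x, y), where the double series defining F₂ converges since x+y < 1. -/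
open Real

/-- The Pochhammer symbol `(a)_k = a(a+1)⋯(a+k-1) = Γ(a+k)/Γ(a)`. -/
noncomputable def poch (a : ℝ) (k : ℕ) : ℝ := ∏ i ∈ Finset.range k, (a + (i : ℝ))

/-- The second Appell hypergeometric function
`F₂(a; b₁,b₂; c₁,c₂; x,y) = Σ_{i,j} (a)_{i+j}(b₁)_i(b₂)_j/((c₁)_i(c₂)_j i! j!) xⁱ yʲ`. -/
noncomputable def F2 (a b₁ b₂ c₁ c₂ x y : ℝ) : ℝ :=
  ∑' (i : ℕ) (j : ℕ),
    poch a (i + j) * poch b₁ i * poch b₂ j /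
      (poch c₁ i * poch c₂ j * (Nat.factorial i : ℝ) * (Nat.factorial j : ℝ)) * x ^ i * y ^ j

lemma poch_add (a : ℝ) (m n : ℕ) : poch a (m + n) = poch a m * poch (a + m) n := by
  unfold poch
  rw [Finset.prod_range_add]
  congr 1
  apply Finset.prod_congr rfl
  intro i _
  push_cast
  ring

lemma poch_pos (a : ℝ) (ha : 0 < a) (n : ℕ) : 0 < poch a n :=
  Finset.prod_pos fun i _ => by positivity

lemma choose_eq_poch (a : ℝ) (n : ℕ) :
    Ring.choose (a + n - 1) n = poch a n / (n.factorial : ℝ) := by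
  have h : ∀ m : ℕ, (ascPochhammer ℝ m).eval a = poch a m := by
    intro m
    induction m with
    | zero => simp [poch]
    | succ m ih =>
      rw [ascPochhammer_succ_eval, ih]
      simp [poch, Finset.prod_range_succ]
  rw [Ring.choose_eq_smul, Polynomial.descPochhammer_smeval_eq_ascPochhammer,
    Polynomial.ascPochhammer_smeval_cast, Polynomial.ascPochhammer_smeval_eq_eval,
    show a + n - 1 - n + 1 = a by ring, h]
  rw [smul_eq_mul]
  ring

lemma binom_hasSum (a t : ℝ) (ht : |t| < 1) :
    HasSum (fun m : ℕ => poch a m / (m.factorial : ℝ) * t ^ m) ((1 - t) ^ (-a)) := by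
  have h := (Real.one_div_one_sub_rpow_hasFPowerSeriesOnBall_zero a).hasSum (y := t)
    (by simpa [enorm_eq_nnnorm, ← NNReal.coe_lt_coe] using ht)
  simp only [zero_add, FormalMultilinearSeries.ofScalars_apply_eq, choose_eq_poch, smul_eq_mul] at h
  have h1 : 0 ≤ 1 - t := by linarith [(abs_lt.mp ht).2]
  rw [Real.rpow_neg h1]
  simpa using h

/-- coefficients of the double series for `(1 - x - y) ^ (-a)` -/
noncomputable def cf (a : ℝ) (p : ℕ × ℕ) : ℝ :=
  poch a (p.1 + p.2) / ((p.1.factorial : ℝ) * (p.2.factorial : ℝ))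

lemma cf_antidiag (a x y : ℝ) (f : ℝ → ℝ) (hf : ∀ u v : ℝ, 0 ≤ v → f (u * v) = f u * v) (m : ℕ) :
    ∑ p ∈ Finset.HasAntidiagonal.antidiagonal m, f (cf a p) * (x ^ p.1 * y ^ p.2)
      = f (poch a m / (m.factorial : ℝ)) * (x + y) ^ m := by
  rw [(Commute.all x y).add_pow', Finset.mul_sum]
  apply Finset.sum_congr rfl
  intro p hp
  rw [Finset.HasAntidiagonal.mem_antidiagonal] at hp
  have e : cf a p = poch a m / (m.factorial : ℝ) * (m.choose p.1 : ℝ) := by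
    unfold cf
    rw [hp, ← hp, Nat.cast_add_choose]
    have := (p.1 + p.2).factorial_ne_zero
    field_simp
  rw [e, hf _ _ (by positivity)]
  simp only [nsmul_eq_mul]
  ring

lemma cf_summable (a x y : ℝ) (hx : 0 ≤ x) (hy : 0 ≤ y) (hxy : x + y < 1) :
    Summable (fun p : ℕ × ℕ => |cf a p| * (x ^ p.1 * y ^ p.2)) := by
  rw [← Finset.HasAntidiagonal.sigmaAntidiagonalEquivProd.summable_iff,
    summable_sigma_of_nonneg (fun p => by simp only [Function.comp]; positivity)]
  refine ⟨fun m => Summable.of_finite, ?_⟩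
  have h := (binom_hasSum a (x + y) (by rw [abs_of_nonneg (by positivity)]; exact hxy)).summable.abs
  refine h.congr fun m => ?_
  rw [tsum_fintype, Finset.univ_eq_attach]
  have := Finset.sum_attach (Finset.HasAntidiagonal.antidiagonal m) (fun p => |cf a p| * (x ^ p.1 * y ^ p.2))
  simp only [Function.comp, Finset.HasAntidiagonal.sigmaAntidiagonalEquivProd_apply]
  rw [this, cf_antidiag a x y (fun u => |u|) (fun u v hv => by
    simp only [abs_mul, abs_of_nonneg hv]), abs_mul, abs_of_nonneg (by positivity : 0 ≤ (x + y) ^ m)]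

lemma cf_tsum (a x y : ℝ) (hx : 0 ≤ x) (hy : 0 ≤ y) (hxy : x + y < 1) :
    ∑' p : ℕ × ℕ, cf a p * (x ^ p.1 * y ^ p.2) = (1 - x - y) ^ (-a) := by
  have hs : Summable (fun p : ℕ × ℕ => cf a p * (x ^ p.1 * y ^ p.2)) := by
    refine Summable.of_abs ((cf_summable a x y hx hy hxy).congr fun p => ?_)
    rw [abs_mul, abs_of_nonneg (by positivity : 0 ≤ x ^ p.1 * y ^ p.2)]
  have h := binom_hasSum a (x + y) (by rw [abs_of_nonneg (by positivity)]; exact hxy)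
  have hs' := Finset.HasAntidiagonal.sigmaAntidiagonalEquivProd.summable_iff.mpr hs
  simp only [Function.comp_def] at hs'
  rw [← Finset.HasAntidiagonal.sigmaAntidiagonalEquivProd.tsum_eq,
    Summable.tsum_sigma hs', sub_sub, ← h.tsum_eq]
  congr 1
  ext m
  rw [tsum_fintype, Finset.univ_eq_attach]
  have := Finset.sum_attach (Finset.HasAntidiagonal.antidiagonal m) (fun p => cf a p * (x ^ p.1 * y ^ p.2))
  simp only [Finset.HasAntidiagonal.sigmaAntidiagonalEquivProd_apply]
  rw [this, cf_antidiag a x y (fun u => u) (fun u v hv => rfl)]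

/-- absolute convergence on `(0, r)` -/
def AbsConv {ι : Type} (a : ι → ℝ) (e : ι → ℕ) (r : ℝ) : Prop :=
  ∀ t : ℝ, 0 < t → t < r → Summable (fun p => |a p| * t ^ e p)

lemma bdd_aux (c q : ℝ) (hq : 0 ≤ q) (hq1 : q < 1) :
    ∃ C : ℝ, ∀ j : ℕ, |c + j| * q ^ j ≤ C := by
  have h1 := tendsto_pow_const_mul_const_pow_of_abs_lt_one 1
    (by rwa [abs_of_nonneg hq] : |q| < 1)
  have h2 := h1.bddAbove_range
  obtain ⟨C, hC⟩ := h2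
  refine ⟨|c| + C, fun j => ?_⟩
  have h3 : (j : ℝ) ^ 1 * q ^ j ≤ C := hC ⟨j, rfl⟩
  have h4 : q ^ j ≤ 1 := pow_le_one₀ hq hq1.le
  have h5 : |c + j| ≤ |c| + j := (abs_add_le _ _).trans (by simp)
  have h6 : 0 ≤ q ^ j := by positivity
  calc |c + j| * q ^ j ≤ (|c| + j) * q ^ j := by gcongr
    _ = |c| * q ^ j + j ^ 1 * q ^ j := by ring
    _ ≤ |c| * 1 + C := by gcongr
    _ = _ := by ring

lemma AbsConv.step {ι : Type} {a : ι → ℝ} {e : ι → ℕ} {r : ℝ} (h : AbsConv a e r) (c : ℝ) :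
    AbsConv (fun p => a p * (c + e p)) e r := by
  intro t ht htr
  obtain ⟨u, htu, hur⟩ := exists_between htr
  have hu : 0 < u := ht.trans htu
  obtain ⟨C, hC⟩ := bdd_aux c (t / u) (by positivity) ((div_lt_one hu).mpr htu)
  refine Summable.of_nonneg_of_le (fun p => by positivity) (fun p => ?_) ((h u hu hur).mul_left C)
  have := hC (e p)
  calc |a p * (c + e p)| * t ^ e p = |a p| * u ^ e p * (|c + e p| * (t / u) ^ e p) := by
        rw [abs_mul, div_pow]; field_simp
    _ ≤ |a p| * u ^ e p * C := by gcongr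
    _ = _ := by ring

lemma AbsConv.hasDerivAt {ι : Type} {a : ι → ℝ} {e : ι → ℕ} {r : ℝ} (h : AbsConv a e r) (c : ℝ)
    (t : ℝ) (ht : 0 < t) (htr : t < r) :
    HasDerivAt (fun s : ℝ => s ^ c * ∑' p, a p * s ^ e p)
      (t ^ (c - 1) * ∑' p, a p * (c + e p) * t ^ e p) t := by
  obtain ⟨u, htu, hur⟩ := exists_between htr
  have hu : 0 < u := ht.trans htu
  simp only [← tsum_mul_left]
  refine hasDerivAt_tsum_of_isPreconnected (t := Set.Ioo (t / 2) u) (y₀ := t)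
    (u := fun p => ((t / 2) ^ (c - 1) + u ^ (c - 1)) * (|a p * (c + e p)| * u ^ e p))
    (g := fun p s => s ^ c * (a p * s ^ e p))
    (g' := fun p s => s ^ (c - 1) * (a p * (c + e p) * s ^ e p))
    (((h.step c) u hu hur).mul_left _) isOpen_Ioo isPreconnected_Ioo ?_ ?_
    ⟨by linarith, htu⟩ ?_ ⟨by linarith, htu⟩
  · rintro p s ⟨hs, -⟩
    have hs0 : 0 < s := by linarith
    have h1 := (Real.hasDerivAt_rpow_const (x := s) (p := c) (Or.inl hs0.ne')).mul
      ((hasDerivAt_pow (e p) s).const_mul (a p))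
    convert! h1 using 1
    have h2 : s ^ c = s ^ (c - 1) * s := by
      rw [← Real.rpow_add_one hs0.ne']; ring_nf
    rw [h2]
    rcases Nat.eq_zero_or_pos (e p) with h0 | h0
    · simp [h0]; ring
    · obtain ⟨m, hm⟩ : ∃ m, e p = m + 1 := ⟨e p - 1, by omega⟩
      rw [hm, Nat.add_sub_cancel, pow_succ]
      ring
  · rintro p s ⟨hs, hs'⟩
    have hs0 : 0 < s := by linarith
    have h1 : s ^ (c - 1) ≤ (t / 2) ^ (c - 1) + u ^ (c - 1) := by
      have e1 : 0 ≤ (t / 2) ^ (c - 1) := by positivity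
      have e2 : 0 ≤ u ^ (c - 1) := by positivity
      rcases le_total 0 (c - 1) with h0 | h0
      · have := Real.rpow_le_rpow hs0.le hs'.le h0
        linarith
      · have := Real.rpow_le_rpow_of_nonpos (by positivity : 0 < t / 2) hs.le h0
        linarith
    rw [Real.norm_eq_abs, abs_mul, abs_mul _ (s ^ e p), abs_of_nonneg (by positivity : 0 ≤ s ^ (c - 1)),
      abs_of_nonneg (by positivity : 0 ≤ s ^ e p)]
    gcongr
  · refine Summable.mul_left _ (Summable.of_abs ((h t ht htr).congr fun p => ?_))
    rw [abs_mul, abs_of_nonneg (by positivity : 0 ≤ t ^ e p)]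

/-- falling product -/
noncomputable def fp (c : ℝ) (l : ℕ) (j : ℕ) : ℝ := ∏ i ∈ Finset.range l, (c - i + j)

lemma AbsConv.iter {ι : Type} {a : ι → ℝ} {e : ι → ℕ} {r : ℝ} (h : AbsConv a e r) (c : ℝ) (l : ℕ) :
    AbsConv (fun p => a p * fp c l (e p)) e r := by
  induction l with
  | zero => simpa [fp] using h
  | succ l ih =>
    have := ih.step (c - l)
    simpa [fp, Finset.prod_range_succ, mul_assoc] using this

lemma AbsConv.iteratedDeriv_eq {ι : Type} {a : ι → ℝ} {e : ι → ℕ} {r : ℝ} (h : AbsConv a e r)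
    (c : ℝ) (f : ℝ → ℝ) (hf : ∀ t, 0 < t → t < r → f t = t ^ c * ∑' p, a p * t ^ e p) (l : ℕ) :
    ∀ t, 0 < t → t < r →
      iteratedDeriv l f t = t ^ (c - l) * ∑' p, a p * fp c l (e p) * t ^ e p := by
  induction l with
  | zero => simpa [fp] using hf
  | succ l ih =>
    intro t ht htr
    rw [iteratedDeriv_succ]
    have h1 := (h.iter c l).hasDerivAt (c - l) t ht htr
    have h2 : iteratedDeriv l f =ᶠ[nhds t]
        fun s => s ^ (c - l) * ∑' p, a p * fp c l (e p) * s ^ e p := by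
      filter_upwards [Ioo_mem_nhds ht htr] with s hs
      exact ih s hs.1 hs.2
    rw [h2.deriv_eq, h1.deriv]
    simp only [fp, Finset.prod_range_succ, mul_assoc]
    congr 2
    push_cast
    ring

lemma fp_eq (α : ℝ) (hα : -1 < α) (k i : ℕ) :
    fp ((k : ℝ) + α) k i = poch (α + 1) k * poch (α + 1 + k) i / poch (α + 1) i := by
  have h0 := (poch_pos (α + 1) (by linarith) i).ne'
  rw [eq_div_iff h0, ← poch_add, add_comm k i, poch_add, mul_comm]
  congr 1
  unfold fp poch
  rw [← Finset.prod_range_reflect]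
  apply Finset.prod_congr rfl
  intro m hm
  rw [Finset.mem_range] at hm
  rw [show k - 1 - m = k - (m + 1) by omega, Nat.cast_sub (by omega)]
  push_cast
  ring

/-- `U_{k,n}^{α,β,γ}(x,y) = (α+1)_k (β+1)_{n-k} (1-x-y)^{-γ}
F₂(-γ-n; α+1+k, β+1+n-k; α+1, β+1; x, y)`, the `F₂` double series converging
since `x + y < 1`. -/
theorem stmt2 (k n : ℕ) (hkn : k ≤ n) (α β γ : ℝ)
    (hα : -1 < α) (hβ : -1 < β) (hγ : -1 < γ)
    (x y : ℝ) (hx : 0 < x) (hy : 0 < y) (hxy : x + y < 1) :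
    Summable (fun p : ℕ × ℕ =>
        poch (-γ - (n : ℝ)) (p.1 + p.2) * poch (α + 1 + k) p.1 *
          poch (β + 1 + ((n : ℝ) - (k : ℝ))) p.2 /
          (poch (α + 1) p.1 * poch (β + 1) p.2 *
            (Nat.factorial p.1 : ℝ) * (Nat.factorial p.2 : ℝ)) * x ^ p.1 * y ^ p.2)
    ∧ Ukn α β γ k n x y
      = poch (α + 1) k * poch (β + 1) (n - k) * (1 - x - y) ^ (-γ) *
        F2 (-γ - (n : ℝ)) (α + 1 + k) (β + 1 + ((n : ℝ) - (k : ℝ))) (α + 1) (β + 1) x y := by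
  obtain ⟨l, rfl⟩ := Nat.exists_eq_add_of_le hkn
  have hl : ((k + l : ℕ) : ℝ) - (k : ℝ) = l := by push_cast; ring
  rw [hl]
  unfold Ukn pderiv2 F2
  rw [hl, Nat.add_sub_cancel_left]
  set N : ℝ := ((k + l : ℕ) : ℝ) + γ with hN
  have hN' : -γ - ((k + l : ℕ) : ℝ) = -N := by rw [hN]; ring
  rw [hN']
  have hc1 : ∀ s, 0 < s → AbsConv (fun p : ℕ × ℕ => s ^ ((k : ℝ) + α) * (cf (-N) p * s ^ p.1))
      Prod.snd (1 - s) := by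
    intro s hs t ht hts
    refine ((cf_summable (-N) s t hs.le ht.le (by linarith)).mul_left (s ^ ((k : ℝ) + α))).congr
      fun p => ?_
    rw [abs_mul, abs_mul, abs_of_nonneg (by positivity : 0 ≤ s ^ ((k : ℝ) + α)),
      abs_of_nonneg (by positivity : 0 ≤ s ^ p.1)]
    ring
  have hinner : ∀ s, 0 < s → s < 1 - y →
      iteratedDeriv l (fun t => s ^ ((k : ℝ) + α) * t ^ ((l : ℝ) + β) * (1 - s - t) ^ N) y
      = s ^ ((k : ℝ) + α) *
        ∑' p : ℕ × ℕ, (y ^ β * (cf (-N) p * fp ((l : ℝ) + β) l p.2 * y ^ p.2)) * s ^ p.1 := by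
    intro s hs hsy
    rw [(hc1 s hs).iteratedDeriv_eq ((l : ℝ) + β) _ ?_ l y hy (by linarith)]
    · rw [show (l : ℝ) + β - l = β by ring, ← tsum_mul_left, ← tsum_mul_left]
      congr 1
      ext p
      ring
    · intro t ht hts
      have := cf_tsum (-N) s t hs.le ht.le (by linarith)
      rw [neg_neg] at this
      rw [← this, ← tsum_mul_left, ← tsum_mul_left]
      congr 1
      ext p
      ring
  have hc2 : AbsConv (fun p : ℕ × ℕ => y ^ β * (cf (-N) p * fp ((l : ℝ) + β) l p.2 * y ^ p.2))
      Prod.fst (1 - y) := by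
    intro s hs hsy
    have h1 := ((hc1 s hs).iter ((l : ℝ) + β) l y hy (by linarith)).mul_left
      (y ^ β * (s ^ ((k : ℝ) + α))⁻¹)
    refine h1.congr fun p => ?_
    have h2 : 0 < s ^ ((k : ℝ) + α) := by positivity
    simp only [abs_mul]
    rw [abs_of_pos h2, abs_of_nonneg (by positivity : 0 ≤ y ^ β),
      abs_of_nonneg (by positivity : 0 ≤ s ^ p.1), abs_of_nonneg (by positivity : 0 ≤ y ^ p.2)]
    field_simp
  have houter := hc2.iteratedDeriv_eq ((k : ℝ) + α) _ hinner k x hx (by linarith)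
  have hsum := hc2.iter ((k : ℝ) + α) k x hx (by linarith)
  have hA := poch_pos (α + 1) (by linarith) k
  have hB := poch_pos (β + 1) (by linarith) l
  have hyb : 0 < y ^ β := by positivity
  have hxa : 0 < x ^ α := by positivity
  have hterm : ∀ p : ℕ × ℕ,
      y ^ β * (cf (-N) p * fp ((l : ℝ) + β) l p.2 * y ^ p.2) * fp ((k : ℝ) + α) k p.1 * x ^ p.1
      = (y ^ β * poch (α + 1) k * poch (β + 1) l) * (poch (-N) (p.1 + p.2) * poch (α + 1 + k) p.1 *
          poch (β + 1 + l) p.2 / (poch (α + 1) p.1 * poch (β + 1) p.2 *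
            (Nat.factorial p.1 : ℝ) * (Nat.factorial p.2 : ℝ)) * x ^ p.1 * y ^ p.2) := by
    intro p
    rw [fp_eq α hα, fp_eq β hβ, cf]
    have h1 := (poch_pos (α + 1) (by linarith) p.1).ne'
    have h2 := (poch_pos (β + 1) (by linarith) p.2).ne'
    field_simp
  have hS : Summable (fun p : ℕ × ℕ => poch (-N) (p.1 + p.2) * poch (α + 1 + k) p.1 *
          poch (β + 1 + l) p.2 / (poch (α + 1) p.1 * poch (β + 1) p.2 *
            (Nat.factorial p.1 : ℝ) * (Nat.factorial p.2 : ℝ)) * x ^ p.1 * y ^ p.2) := by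
    rw [← summable_mul_left_iff (a := y ^ β * poch (α + 1) k * poch (β + 1) l) (by positivity)]
    refine Summable.of_abs (hsum.congr fun p => ?_)
    rw [← hterm p, abs_mul _ (x ^ p.1), abs_of_nonneg (by positivity : 0 ≤ x ^ p.1)]
  refine ⟨hS, ?_⟩
  rw [houter, tsum_congr hterm, tsum_mul_left, hS.tsum_prod, show (k : ℝ) + α - k = α by ring,
    Real.rpow_neg (by linarith)]
  have hz : 0 < (1 - x - y) ^ γ := Real.rpow_pos_of_pos (by linarith) _
  field_simp
end

section
/- Let α,β,γ > -1 be real and 0 ≤ k ≤ n integers. For all integers 0 ≤ l ≤ m ≤ n with (m,l) ≠ (n,n-k), the moment ∬_{T²} U_{k,n}^{α,β,γ}(u,v) · u^{m-l} v^{l} · W_{α,β,γ}(u,v) du dv = 0. -/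
open Real MeasureTheory

/-- The normalized Jacobi weight on the triangle,
`W_{α,β,γ}(x,y) = x^α y^β (1-x-y)^γ / B(α+1,β+1,γ+1)`. -/
noncomputable def Wt (α β γ : ℝ) (x y : ℝ) : ℝ :=
  x ^ α * y ^ β * (1 - x - y) ^ γ / Beta3 (α + 1) (β + 1) (γ + 1)

/-- The biorthogonal (monic-basis) polynomial `V_{m,n}^{α,β,γ}`. -/
noncomputable def Vmn (α β γ : ℝ) (m n : ℕ) (x y : ℝ) : ℝ :=
  ∑ i ∈ Finset.range (m + 1), ∑ j ∈ Finset.range (n + 1),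
    (-1 : ℝ) ^ (m + n + i + j) * (m.choose i : ℝ) * (n.choose j : ℝ) *
      (poch (α + 1) m * poch (β + 1) n * poch (α + β + γ + 2) (m + n + i + j)) /
      (poch (α + 1) i * poch (β + 1) j * poch (α + β + γ + 2) (2 * m + 2 * n)) *
      x ^ i * y ^ j

/-- Families of two-variable functions indexed by three exponents. -/
abbrev AFam := ℝ → ℝ → ℝ → ℝ → ℝ → ℝ

noncomputable def AF0 : AFam := fun a b c u v => u ^ a * v ^ b * (1 - u - v) ^ c

noncomputable def AX (F : AFam) : AFam :=
  fun a b c u v => a * F (a - 1) b c u v - c * F a b (c - 1) u v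

noncomputable def AY (F : AFam) : AFam :=
  fun a b c u v => b * F a (b - 1) c u v - c * F a b (c - 1) u v

lemma AXY_comm : Function.Commute AX AY := by
  intro F
  funext a b c u v
  simp only [AX, AY]
  ring

def DU (F : AFam) : Prop := ∀ a b c u v : ℝ, 0 < u → 0 < v → 0 < 1 - u - v →
  HasDerivAt (fun s => F a b c s v) (AX F a b c u v) u

def DV (F : AFam) : Prop := ∀ a b c u v : ℝ, 0 < u → 0 < v → 0 < 1 - u - v →
  HasDerivAt (fun t => F a b c u t) (AY F a b c u v) v

lemma DU_AF0 : DU AF0 := by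
  intro a b c u v hu hv hw
  have h1 : HasDerivAt (fun s : ℝ => s ^ a) (a * u ^ (a - 1)) u :=
    Real.hasDerivAt_rpow_const (Or.inl hu.ne')
  have h2 : HasDerivAt (fun s : ℝ => (1 - s - v)) (-1) u := by
    simpa using ((hasDerivAt_id u).const_sub 1).sub_const v
  have h3 := h2.rpow_const (p := c) (Or.inl hw.ne')
  refine HasDerivAt.congr_deriv ((h1.mul_const (v ^ b)).mul h3) ?_
  simp only [AX, AF0]
  ring

lemma DV_AF0 : DV AF0 := by
  intro a b c u v hu hv hw
  have h1 : HasDerivAt (fun s : ℝ => s ^ b) (b * v ^ (b - 1)) v :=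
    Real.hasDerivAt_rpow_const (Or.inl hv.ne')
  have h2 : HasDerivAt (fun s : ℝ => (1 - u - s)) (-1) v := by
    simpa using (hasDerivAt_id v).const_sub (1 - u)
  have h3 := h2.rpow_const (p := c) (Or.inl hw.ne')
  refine HasDerivAt.congr_deriv ((h1.const_mul (u ^ a)).mul h3) ?_
  simp only [AY, AF0]
  ring

lemma DU_AX {F : AFam} (h : DU F) : DU (AX F) := by
  intro a b c u v hu hv hw
  exact ((h (a-1) b c u v hu hv hw).const_mul a).sub ((h a b (c-1) u v hu hv hw).const_mul c)

lemma DU_AY {F : AFam} (h : DU F) : DU (AY F) := by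
  intro a b c u v hu hv hw
  rw [AXY_comm F]
  exact ((h a (b-1) c u v hu hv hw).const_mul b).sub ((h a b (c-1) u v hu hv hw).const_mul c)

lemma DV_AY {F : AFam} (h : DV F) : DV (AY F) := by
  intro a b c u v hu hv hw
  exact ((h a (b-1) c u v hu hv hw).const_mul b).sub ((h a b (c-1) u v hu hv hw).const_mul c)

lemma DV_AX {F : AFam} (h : DV F) : DV (AX F) := by
  intro a b c u v hu hv hw
  rw [← AXY_comm F]
  exact ((h (a-1) b c u v hu hv hw).const_mul a).sub ((h a b (c-1) u v hu hv hw).const_mul c)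

noncomputable def AG (i j : ℕ) : AFam := AX^[i] (AY^[j] AF0)

lemma AG_succ_left (i j : ℕ) : AG (i+1) j = AX (AG i j) := by
  simp only [AG, Function.iterate_succ_apply']

lemma AG_succ_right (i j : ℕ) : AG i (j+1) = AY (AG i j) := by
  simp only [AG, Function.iterate_succ_apply']
  exact (AXY_comm.iterate_left i) _

lemma AG_zero : AG 0 0 = AF0 := rfl

lemma DUV_AG (i j : ℕ) : DU (AG i j) ∧ DV (AG i j) := by
  induction i with
  | zero =>
    induction j with
    | zero => exact ⟨DU_AF0, DV_AF0⟩
    | succ j ih => rw [AG_succ_right]; exact ⟨DU_AY ih.1, DV_AY ih.2⟩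
  | succ i ih => rw [AG_succ_left]; exact ⟨DU_AX ih.1, DV_AX ih.2⟩

/-- Boundary behaviour in the first variable. -/
def BU (F : AFam) (i s : ℝ) : Prop := ∀ a b c : ℝ, i < a → s < c → ∀ v : ℝ,
  Continuous (fun u => F a b c u v) ∧ F a b c 0 v = 0 ∧ F a b c (1 - v) v = 0

def BV (F : AFam) (j s : ℝ) : Prop := ∀ a b c : ℝ, j < b → s < c → ∀ u : ℝ,
  Continuous (fun v => F a b c u v) ∧ F a b c u 0 = 0 ∧ F a b c u (1 - u) = 0

lemma BU_AF0 : BU AF0 0 0 := by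
  intro a b c ha hc v
  refine ⟨?_, ?_, ?_⟩
  · unfold AF0
    have h1 := Real.continuous_rpow_const ha.le
    have h2 := (Real.continuous_rpow_const hc.le).comp
      (by fun_prop : Continuous (fun u : ℝ => 1 - u - v))
    exact (h1.mul continuous_const).mul h2
  · simp [AF0, Real.zero_rpow ha.ne']
  · simp [AF0, Real.zero_rpow hc.ne']

lemma BV_AF0 : BV AF0 0 0 := by
  intro a b c ha hc v
  refine ⟨?_, ?_, ?_⟩
  · unfold AF0
    have h1 := Real.continuous_rpow_const ha.le
    have h2 := (Real.continuous_rpow_const hc.le).comp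
      (by fun_prop : Continuous (fun u : ℝ => 1 - v - u))
    exact (continuous_const.mul h1).mul h2
  · simp [AF0, Real.zero_rpow ha.ne']
  · simp [AF0, Real.zero_rpow hc.ne']

lemma BU_AX {F : AFam} {i s : ℝ} (h : BU F i s) : BU (AX F) (i+1) (s+1) := by
  intro a b c ha hc v
  obtain ⟨h1, h2, h3⟩ := h (a-1) b c (by linarith) (by linarith) v
  obtain ⟨g1, g2, g3⟩ := h a b (c-1) (by linarith) (by linarith) v
  exact ⟨(continuous_const.mul h1).sub (continuous_const.mul g1),
    by simp [AX, h2, g2], by simp [AX, h3, g3]⟩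

lemma BU_AY {F : AFam} {i s : ℝ} (h : BU F i s) : BU (AY F) i (s+1) := by
  intro a b c ha hc v
  obtain ⟨h1, h2, h3⟩ := h a (b-1) c (by linarith) (by linarith) v
  obtain ⟨g1, g2, g3⟩ := h a b (c-1) (by linarith) (by linarith) v
  exact ⟨(continuous_const.mul h1).sub (continuous_const.mul g1),
    by simp [AY, h2, g2], by simp [AY, h3, g3]⟩

lemma BV_AX {F : AFam} {i s : ℝ} (h : BV F i s) : BV (AX F) i (s+1) := by
  intro a b c ha hc v
  obtain ⟨h1, h2, h3⟩ := h (a-1) b c (by linarith) (by linarith) v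
  obtain ⟨g1, g2, g3⟩ := h a b (c-1) (by linarith) (by linarith) v
  exact ⟨(continuous_const.mul h1).sub (continuous_const.mul g1),
    by simp [AX, h2, g2], by simp [AX, h3, g3]⟩

lemma BV_AY {F : AFam} {i s : ℝ} (h : BV F i s) : BV (AY F) (i+1) (s+1) := by
  intro a b c ha hc v
  obtain ⟨h1, h2, h3⟩ := h a (b-1) c (by linarith) (by linarith) v
  obtain ⟨g1, g2, g3⟩ := h a b (c-1) (by linarith) (by linarith) v
  exact ⟨(continuous_const.mul h1).sub (continuous_const.mul g1),
    by simp [AY, h2, g2], by simp [AY, h3, g3]⟩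

lemma BUV_AG (i j : ℕ) : BU (AG i j) i (i+j) ∧ BV (AG i j) j (i+j) := by
  induction i with
  | zero =>
    induction j with
    | zero => simpa [AG_zero] using And.intro BU_AF0 BV_AF0
    | succ j ih =>
      rw [AG_succ_right]
      refine ⟨?_, ?_⟩
      · convert BU_AY ih.1 using 1; push_cast; ring
      · convert BV_AY ih.2 using 1 <;> push_cast <;> ring
  | succ i ih =>
    rw [AG_succ_left]
    refine ⟨?_, ?_⟩
    · convert BU_AX ih.1 using 1 <;> push_cast <;> ring
    · convert BV_AX ih.2 using 1; push_cast; ring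

lemma iter_v (j : ℕ) (a b c : ℝ) : ∀ u v : ℝ, 0 < u → 0 < v → 0 < 1 - u - v →
    iteratedDeriv j (fun t => AF0 a b c u t) v = AG 0 j a b c u v := by
  induction j with
  | zero => intro u v _ _ _; simp [AG_zero]
  | succ j ih =>
    intro u v hu hv hw
    rw [iteratedDeriv_succ, AG_succ_right]
    refine (((DUV_AG 0 j).2 a b c u v hu hv hw).congr_of_eventuallyEq ?_).deriv
    have e1 : ∀ᶠ t in nhds v, 0 < t := lt_mem_nhds hv
    have e2 : ∀ᶠ t in nhds v, t < 1 - u := gt_mem_nhds (by linarith)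
    filter_upwards [e1, e2] with t h1 h2
    exact ih u t hu h1 (by linarith)

lemma iter_uv (i j : ℕ) (a b c : ℝ) : ∀ u v : ℝ, 0 < u → 0 < v → 0 < 1 - u - v →
    pderiv2 i j (AF0 a b c) u v = AG i j a b c u v := by
  induction i with
  | zero =>
    intro u v hu hv hw
    simpa [pderiv2] using iter_v j a b c u v hu hv hw
  | succ i ih =>
    intro u v hu hv hw
    unfold pderiv2 at ih ⊢
    rw [iteratedDeriv_succ, AG_succ_left]
    refine (((DUV_AG i j).1 a b c u v hu hv hw).congr_of_eventuallyEq ?_).deriv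
    have e1 : ∀ᶠ t in nhds u, 0 < t := lt_mem_nhds hu
    have e2 : ∀ᶠ t in nhds u, t < 1 - v := gt_mem_nhds (by linarith)
    filter_upwards [e1, e2] with t h1 h2
    exact ih t v h1 hv (by linarith)

/-- Repeated integration by parts, phrased as existence of an antiderivative. -/
lemma exists_anti (G : ℕ → ℝ → ℝ) (L : ℝ) (k : ℕ)
    (hc : ∀ i < k, Continuous (G i)) (h0 : ∀ i < k, G i 0 = 0) (h1 : ∀ i < k, G i L = 0)
    (hd : ∀ i < k, ∀ x ∈ Set.Ioo 0 L, HasDerivAt (G i) (G (i+1) x) x) (p : ℕ) :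
    ∀ i, p < i → i ≤ k → ∃ H : ℝ → ℝ, Continuous H ∧ H 0 = 0 ∧ H L = 0 ∧
      ∀ x ∈ Set.Ioo 0 L, HasDerivAt H (x ^ p * G i x) x := by
  induction p with
  | zero =>
    intro i hi hik
    obtain ⟨i, rfl⟩ : ∃ q, i = q + 1 := ⟨i - 1, by omega⟩
    refine ⟨G i, hc i (by omega), h0 i (by omega), h1 i (by omega), fun x hx => ?_⟩
    simpa using hd i (by omega) x hx
  | succ p ih =>
    intro i hi hik
    obtain ⟨i, rfl⟩ : ∃ q, i = q + 1 := ⟨i - 1, by omega⟩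
    obtain ⟨H, c, z0, z1, d⟩ := ih i (by omega) (by omega)
    refine ⟨fun x => x ^ (p+1) * G i x - (p + 1 : ℝ) * H x, ?_, ?_, ?_, fun x hx => ?_⟩
    · exact ((continuous_pow (p+1)).mul (hc i (by omega))).sub (continuous_const.mul c)
    · simp [z0]
    · simp [z1, h1 i (by omega)]
    · refine HasDerivAt.congr_deriv (((hasDerivAt_pow (p+1) x).mul (hd i (by omega) x hx)).sub
        ((d x hx).const_mul (p + 1 : ℝ))) ?_
      push_cast
      ring

lemma int_zero (G : ℕ → ℝ → ℝ) (L : ℝ) (hL : 0 < L) (k : ℕ)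
    (hc : ∀ i < k, Continuous (G i)) (h0 : ∀ i < k, G i 0 = 0) (h1 : ∀ i < k, G i L = 0)
    (hd : ∀ i < k, ∀ x ∈ Set.Ioo 0 L, HasDerivAt (G i) (G (i+1) x) x) (p : ℕ) (hp : p < k) :
    ∫ x in Set.Ioo 0 L, x ^ p * G k x = 0 := by
  by_cases hi : IntegrableOn (fun x => x ^ p * G k x) (Set.Ioo 0 L)
  · obtain ⟨H, c, z0, z1, d⟩ := exists_anti G L k hc h0 h1 hd p k hp le_rfl
    rw [← integral_Ioc_eq_integral_Ioo, ← intervalIntegral.integral_of_le hL.le,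
      intervalIntegral.integral_eq_sub_of_hasDerivAt_of_le hL.le c.continuousOn d, z0, z1, sub_zero]
    rw [intervalIntegrable_iff_integrableOn_Ioo_of_le hL.le]
    exact hi
  · exact integral_undef hi

lemma inner_u (a b c : ℝ) (k j p : ℕ) (hp : p < k) (ha : (k:ℝ) - 1 < a)
    (hc : (k:ℝ) - 1 + j < c) (v : ℝ) (hv : 0 < v) (hv1 : v < 1) :
    ∫ u in Set.Ioo 0 (1 - v), u ^ p * AG k j a b c u v = 0 := by
  have key : ∀ i < k, (i : ℝ) < a ∧ (i : ℝ) + j < c := by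
    intro i hi
    have : (i : ℝ) + 1 ≤ k := by exact_mod_cast hi
    constructor <;> linarith
  refine int_zero (fun i u => AG i j a b c u v) (1 - v) (by linarith) k ?_ ?_ ?_ ?_ p hp
  · intro i hi; exact ((BUV_AG i j).1 a b c (key i hi).1 (key i hi).2 v).1
  · intro i hi; exact ((BUV_AG i j).1 a b c (key i hi).1 (key i hi).2 v).2.1
  · intro i hi; exact ((BUV_AG i j).1 a b c (key i hi).1 (key i hi).2 v).2.2
  · intro i hi x hx
    simp only [AG_succ_left]
    exact (DUV_AG i j).1 a b c x v hx.1 hv (by linarith [hx.2])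

lemma inner_v (a b c : ℝ) (k j p : ℕ) (hp : p < j) (hb : (j:ℝ) - 1 < b)
    (hc : (k:ℝ) + j - 1 < c) (u : ℝ) (hu : 0 < u) (hu1 : u < 1) :
    ∫ v in Set.Ioo 0 (1 - u), v ^ p * AG k j a b c u v = 0 := by
  have key : ∀ i < j, (i : ℝ) < b ∧ (k : ℝ) + i < c := by
    intro i hi
    have : (i : ℝ) + 1 ≤ j := by exact_mod_cast hi
    constructor <;> linarith
  refine int_zero (fun i v => AG k i a b c u v) (1 - u) (by linarith) j ?_ ?_ ?_ ?_ p hp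
  · intro i hi; exact ((BUV_AG k i).2 a b c (key i hi).1 (key i hi).2 u).1
  · intro i hi; exact ((BUV_AG k i).2 a b c (key i hi).1 (key i hi).2 u).2.1
  · intro i hi; exact ((BUV_AG k i).2 a b c (key i hi).1 (key i hi).2 u).2.2
  · intro i hi x hx
    simp only [AG_succ_right]
    exact (DUV_AG k i).2 a b c u x hu hx.1 (by linarith [hx.2])

lemma T2_measurable : MeasurableSet T2 := by
  have h : IsClosed T2 := by
    unfold T2
    exact (isClosed_le continuous_const continuous_fst).inter
      ((isClosed_le continuous_const continuous_snd).inter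
        (isClosed_le (continuous_fst.add continuous_snd) continuous_const))
  exact h.measurableSet

lemma fubini_u (f : ℝ × ℝ → ℝ)
    (h : ∀ v, 0 < v → v < 1 → ∫ u in Set.Ioo 0 (1 - v), f (u, v) = 0) :
    ∫ p in T2, f p = 0 := by
  rw [← integral_indicator T2_measurable]
  by_cases hi : Integrable (T2.indicator f)
  · rw [Measure.volume_eq_prod] at hi ⊢
    rw [integral_prod_symm _ hi]
    apply integral_eq_zero_of_ae
    have n0 : ∀ᵐ v : ℝ, v ≠ 0 := by simp [ae_iff]
    have n1 : ∀ᵐ v : ℝ, v ≠ 1 := by simp [ae_iff]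
    filter_upwards [n0, n1] with v h0 h1
    simp only [Pi.zero_apply]
    by_cases hv : 0 < v ∧ v < 1
    · have : (fun u => T2.indicator f (u, v)) =
          (Set.Icc 0 (1 - v)).indicator (fun u => f (u, v)) := by
        funext u
        by_cases hu : u ∈ Set.Icc 0 (1 - v)
        · rw [Set.indicator_of_mem hu, Set.indicator_of_mem]
          exact ⟨hu.1, hv.1.le, by have := hu.2; dsimp only; linarith⟩
        · rw [Set.indicator_of_notMem hu, Set.indicator_of_notMem]
          rintro ⟨q1, q2, q3⟩
          dsimp only at q1 q2 q3
          exact hu ⟨q1, by linarith⟩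
      rw [this, integral_indicator measurableSet_Icc, integral_Icc_eq_integral_Ioo]
      exact h v hv.1 hv.2
    · have : (fun u => T2.indicator f (u, v)) = fun _ => 0 := by
        funext u
        rw [Set.indicator_of_notMem]
        rintro ⟨q1, q2, q3⟩
        dsimp only at q1 q2 q3
        exact hv ⟨lt_of_le_of_ne q2 (Ne.symm h0), lt_of_le_of_ne (by linarith) h1⟩
      rw [this, integral_zero]
  · exact integral_undef hi

lemma fubini_v (f : ℝ × ℝ → ℝ)
    (h : ∀ u, 0 < u → u < 1 → ∫ v in Set.Ioo 0 (1 - u), f (u, v) = 0) :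
    ∫ p in T2, f p = 0 := by
  rw [← integral_indicator T2_measurable]
  by_cases hi : Integrable (T2.indicator f)
  · rw [Measure.volume_eq_prod] at hi ⊢
    rw [integral_prod _ hi]
    apply integral_eq_zero_of_ae
    have n0 : ∀ᵐ v : ℝ, v ≠ 0 := by simp [ae_iff]
    have n1 : ∀ᵐ v : ℝ, v ≠ 1 := by simp [ae_iff]
    filter_upwards [n0, n1] with v h0 h1
    simp only [Pi.zero_apply]
    by_cases hv : 0 < v ∧ v < 1
    · have : (fun u => T2.indicator f (v, u)) =
          (Set.Icc 0 (1 - v)).indicator (fun u => f (v, u)) := by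
        funext u
        by_cases hu : u ∈ Set.Icc 0 (1 - v)
        · rw [Set.indicator_of_mem hu, Set.indicator_of_mem]
          exact ⟨hv.1.le, hu.1, by have := hu.2; dsimp only; linarith⟩
        · rw [Set.indicator_of_notMem hu, Set.indicator_of_notMem]
          rintro ⟨q1, q2, q3⟩
          dsimp only at q1 q2 q3
          exact hu ⟨q2, by linarith⟩
      rw [this, integral_indicator measurableSet_Icc, integral_Icc_eq_integral_Ioo]
      exact h v hv.1 hv.2
    · have : (fun u => T2.indicator f (v, u)) = fun _ => 0 := by
        funext u
        rw [Set.indicator_of_notMem]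
        rintro ⟨q1, q2, q3⟩
        dsimp only at q1 q2 q3
        exact hv ⟨lt_of_le_of_ne q1 (Ne.symm h0), lt_of_le_of_ne (by linarith) h1⟩
      rw [this, integral_zero]
  · exact integral_undef hi

lemma integrand_eq (α β γ : ℝ) (k n p l : ℕ) (u v : ℝ) (hu : 0 < u) (hv : 0 < v)
    (hw : 0 < 1 - u - v) :
    Ukn α β γ k n u v * u ^ p * v ^ l * Wt α β γ u v =
      (Beta3 (α + 1) (β + 1) (γ + 1))⁻¹ * (u ^ p * v ^ l *
        AG k (n - k) ((k : ℝ) + α) ((n : ℝ) - (k : ℝ) + β) ((n : ℝ) + γ) u v) := by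
  have h := iter_uv k (n - k) ((k : ℝ) + α) ((n : ℝ) - (k : ℝ) + β) ((n : ℝ) + γ) u v hu hv hw
  unfold Ukn Wt
  rw [← h]
  have hne : u ^ α * v ^ β * (1 - u - v) ^ γ ≠ 0 := by positivity
  change (u ^ α * v ^ β * (1 - u - v) ^ γ)⁻¹ * pderiv2 k (n - k) (AF0 _ _ _) u v * _ * _ * _ = _
  generalize u ^ α * v ^ β * (1 - u - v) ^ γ = w at hne ⊢
  generalize pderiv2 _ _ _ _ _ = d
  rw [div_eq_mul_inv]
  generalize (Beta3 (α + 1) (β + 1) (γ + 1))⁻¹ = B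
  field_simp

/-- Vanishing of the lower-order moments of `U_{k,n}^{α,β,γ}` against the
Jacobi weight on the triangle. -/
theorem stmt4 (α β γ : ℝ) (hα : -1 < α) (hβ : -1 < β) (hγ : -1 < γ)
    (k n : ℕ) (hkn : k ≤ n) (l m : ℕ) (hlm : l ≤ m) (hmn : m ≤ n)
    (hne : (m, l) ≠ (n, n - k)) :
    ∫ p in T2, Ukn α β γ k n p.1 p.2 * p.1 ^ (m - l) * p.2 ^ l * Wt α β γ p.1 p.2 = 0 := by
  have hcast : ((n - k : ℕ) : ℝ) = (n : ℝ) - k := Nat.cast_sub hkn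
  have hcases : m - l < k ∨ l < n - k := by
    by_contra hcon
    push Not at hcon
    apply hne
    rw [Prod.mk.injEq]
    omega
  rcases hcases with hp | hp
  · refine fubini_u _ fun v hv hv1 => ?_
    rw [setIntegral_congr_fun (g := fun u => ((Beta3 (α + 1) (β + 1) (γ + 1))⁻¹ * v ^ l) *
      (u ^ (m - l) * AG k (n - k) ((k : ℝ) + α) ((n : ℝ) - (k : ℝ) + β) ((n : ℝ) + γ) u v))
      measurableSet_Ioo, integral_const_mul, inner_u _ _ _ _ _ _ hp _ _ v hv hv1, mul_zero]
    · linarith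
    · rw [hcast]; linarith
    · intro u hu
      dsimp only
      rw [integrand_eq _ _ _ _ _ _ _ _ _ hu.1 hv (by linarith [hu.2])]
      ring
  · refine fubini_v _ fun u hu hu1 => ?_
    rw [setIntegral_congr_fun (g := fun v => ((Beta3 (α + 1) (β + 1) (γ + 1))⁻¹ * u ^ (m - l)) *
      (v ^ l * AG k (n - k) ((k : ℝ) + α) ((n : ℝ) - (k : ℝ) + β) ((n : ℝ) + γ) u v))
      measurableSet_Ioo, integral_const_mul, inner_v _ _ _ _ _ _ hp _ _ u hu hu1, mul_zero]
    · rw [hcast]; linarith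
    · rw [hcast]; linarith
    · intro v hv
      dsimp only
      rw [integrand_eq _ _ _ _ _ _ _ _ _ hu hv.1 (by linarith [hv.2])]
      ring
end
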